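/- Let Q be a quasi-order. If (C'_{ω₁}, ⪯) is a bqo, then (C, ⪯) is a wqo, i.e. the class of all Q-cclos is well-quasi-ordered by smc-embeddability ⪯. -/

import Mathlib

open Set Filter Topology

/-- A `Q`-labeled countable closed linear ordering (`Q`-cclo): a function whose
domain is a countable closed subset of `ℝ` and whose values lie in `Q`. -/
structure QCclo (Q : Type) where
  dom : Set ℝ
  dom_countable : dom.Countable
  dom_closed : IsClosed dom
  val : ℝ → Q

/-- `h` is a strictly monotone continuous (smc-) embedding of `V₁` into `V₂`. -/
def IsSmcEmbedding (V₁ V₂ : Set ℝ) (h : ℝ → ℝ) : Prop :=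
  (∀ x ∈ V₁, h x ∈ V₂) ∧
  (∀ x ∈ V₁, ∀ y ∈ V₁, x < y → h x < h y) ∧
  ContinuousOn h V₁

/-- `A ⪯ B`: there is an smc-embedding of `dom A` into `dom B` increasing labels. -/
def QCclo.Emb {Q : Type} [Preorder Q] (A B : QCclo Q) : Prop :=
  ∃ h : ℝ → ℝ, IsSmcEmbedding A.dom B.dom h ∧ ∀ a ∈ A.dom, A.val a ≤ B.val (h a)

/-- Bi-embeddability of `Q`-cclos. -/
def QCclo.Equiv {Q : Type} [Preorder Q] (A B : QCclo Q) : Prop :=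
  QCclo.Emb A B ∧ QCclo.Emb B A

/-- `A < B` for domains: one of them is empty, or they are separated
by an open interval (here witnessed by a point strictly between them). -/
def DomLt (A B : Set ℝ) : Prop :=
  A = ∅ ∨ B = ∅ ∨ ∃ c : ℝ, (∀ a ∈ A, a < c) ∧ ∀ b ∈ B, c < b

/-- `L` is the sum `L₀ + L₁ + ⋯ + p + ⋯ + ¹L + ⁰L` (with `Ls n = L_n`,
`Rs n = ⁿL`, central point `x` labeled `p`). -/
def IsOmegaSum {Q : Type} (L : QCclo Q) (Ls Rs : ℕ → QCclo Q) (p : Q) (x : ℝ) : Prop :=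
  ((∀ n, (Ls n).dom = ∅) ∨ ∀ n, (Ls n).dom.Nonempty) ∧
  ((∀ n, (Rs n).dom = ∅) ∨ ∀ n, (Rs n).dom.Nonempty) ∧
  (¬ ((∀ n, (Ls n).dom = ∅) ∧ ∀ n, (Rs n).dom = ∅)) ∧
  (∀ n, DomLt (Ls n).dom (Ls (n+1)).dom) ∧
  (∀ n, DomLt (Ls (n+1)).dom (Rs (n+1)).dom) ∧
  (∀ n, DomLt (Rs (n+1)).dom (Rs n).dom) ∧
  (∀ a : ℕ → ℝ, (∀ n, a n ∈ (Ls n).dom) → Tendsto a atTop (𝓝 x)) ∧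
  (∀ a : ℕ → ℝ, (∀ n, a n ∈ (Rs n).dom) → Tendsto a atTop (𝓝 x)) ∧
  L.dom = (⋃ n, (Ls n).dom) ∪ {x} ∪ ⋃ n, (Rs n).dom ∧
  (∀ n, ∀ y ∈ (Ls n).dom, L.val y = (Ls n).val y) ∧
  (∀ n, ∀ y ∈ (Rs n).dom, L.val y = (Rs n).val y) ∧
  L.val x = p

/-- `L` is the finite sum `L₁ + ⋯ + L_n` of the nonempty `Q`-cclos `Ls 0, …, Ls (n-1)`. -/
def IsFinSum {Q : Type} (L : QCclo Q) (n : ℕ) (Ls : Fin n → QCclo Q) : Prop :=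
  0 < n ∧ (∀ i, (Ls i).dom.Nonempty) ∧
  (∀ i j : Fin n, i < j → ∀ a ∈ (Ls i).dom, ∀ b ∈ (Ls j).dom, a < b) ∧
  L.dom = ⋃ i, (Ls i).dom ∧
  ∀ i, ∀ y ∈ (Ls i).dom, L.val y = (Ls i).val y

/-- `S(𝒪)`: finite sums and ω-sums of members of `𝒪`. -/
def SSum {Q : Type} (O : Set (QCclo Q)) : Set (QCclo Q) :=
  {L | (∃ n Ls, IsFinSum L n Ls ∧ ∀ i, Ls i ∈ O) ∨
       ∃ Ls Rs p x, IsOmegaSum L Ls Rs p x ∧ (∀ n, Ls n ∈ O) ∧ ∀ n, Rs n ∈ O}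

/-- `S'(𝒪)`: unbounded ω-sums of members of `𝒪`. -/
def S'Sum {Q : Type} [Preorder Q] (O : Set (QCclo Q)) : Set (QCclo Q) :=
  {L | ∃ Ls Rs p x, IsOmegaSum L Ls Rs p x ∧ (∀ n, Ls n ∈ O) ∧ (∀ n, Rs n ∈ O) ∧
       (∀ n, ∃ k > n, QCclo.Emb (Ls n) (Ls k)) ∧
       ∀ n, ∃ k > n, QCclo.Emb (Rs n) (Rs k)}

/-- The hierarchy `C_α`: `C₀` = empty/singleton domains, `C_{α+1} = S(C_α) ∪ C_α`,
unions at limits. -/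
noncomputable def CFam (Q : Type) [Preorder Q] : Ordinal → Set (QCclo Q) := fun α =>
  Ordinal.limitRecOn α
    {L : QCclo Q | L.dom = ∅ ∨ ∃ x : ℝ, L.dom = {x}}
    (fun _ C => SSum C ∪ C)
    (fun _ _ ih => ⋃ (β : Ordinal) (h : β < _), ih β h)

/-- The hierarchy `C'_α`: `C'₀` = empty/singleton domains, `C'_{α+1} = S'(C'_α) ∪ C'_α`,
unions at limits. -/
noncomputable def CFam' (Q : Type) [Preorder Q] : Ordinal → Set (QCclo Q) := fun α =>
  Ordinal.limitRecOn α
    {L : QCclo Q | L.dom = ∅ ∨ ∃ x : ℝ, L.dom = {x}}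
    (fun _ C => S'Sum C ∪ C)
    (fun _ _ ih => ⋃ (β : Ordinal) (h : β < _), ih β h)

/-- A sequence is good for `r` iff `r (f n) (f k)` for some `n < k`;
`r` is a wqo on `S` iff every sequence in `S` is good. -/
def IsWqoOn {P : Type*} (r : P → P → Prop) (S : Set P) : Prop :=
  ∀ f : ℕ → P, (∀ n, f n ∈ S) → ∃ n k, n < k ∧ r (f n) (f k)

/-- `d` extends the finite set `c`: `c = {i ∈ d : i ≤ max c}`. -/
def SExtends (d : Set ℕ) (c : Finset ℕ) : Prop :=
  (c : Set ℕ) = {i ∈ d | ∃ m ∈ c, i ≤ m}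

/-- `B` is a block: an infinite set of finite subsets of `ℕ` such that every infinite
subset of `⋃ B` has an initial segment in `B`. -/
def IsBlock (B : Set (Finset ℕ)) : Prop :=
  B.Infinite ∧
  ∀ X : Set ℕ, X.Infinite → X ⊆ (⋃ b ∈ B, (b : Set ℕ)) → ∃ b ∈ B, SExtends X b

/-- A barrier: a block with no two elements comparable under inclusion. -/
def IsBarrier (B : Set (Finset ℕ)) : Prop :=
  IsBlock B ∧ ∀ b₁ ∈ B, ∀ b₂ ∈ B, b₁ ≠ b₂ → ¬ b₁ ⊆ b₂

/-- Precedence `b₁ ◁ b₂`: there are `i₁ < i₂ < ⋯ < i_m` with `b₁ = {i₁,…,i_k}`,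
`b₂ = {i₂,…,i_m}`, `1 ≤ k < m`. -/
def BarrierPrec (b₁ b₂ : Finset ℕ) : Prop :=
  ∃ (m k : ℕ) (i : ℕ → ℕ), 1 ≤ k ∧ k < m ∧
    StrictMonoOn i (Set.Icc 1 m) ∧
    b₁ = (Finset.Icc 1 k).image i ∧ b₂ = (Finset.Icc 2 m).image i

/-- `f : B → P` is bad: `¬ r (f b₁) (f b₂)` whenever `b₁ ◁ b₂` in `B`. -/
def IsBadOn {P : Type*} (r : P → P → Prop) (B : Set (Finset ℕ)) (f : Finset ℕ → P) : Prop :=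
  ∀ b₁ ∈ B, ∀ b₂ ∈ B, BarrierPrec b₁ b₂ → ¬ r (f b₁) (f b₂)

/-- `r` is a bqo on `S`: every function from a barrier into `S` is good. -/
def IsBqoOn {P : Type*} (r : P → P → Prop) (S : Set P) : Prop :=
  ∀ B : Set (Finset ℕ), IsBarrier B → ∀ f : Finset ℕ → P,
    (∀ b ∈ B, f b ∈ S) → ¬ IsBadOn r B f

/-- `r` is a bqo: every function from a barrier into `P` is good. -/
def IsBqo {P : Type*} (r : P → P → Prop) : Prop :=
  ∀ B : Set (Finset ℕ), IsBarrier B → ∀ f : Finset ℕ → P, ¬ IsBadOn r B f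

section Hierarchy

universe u

theorem CFam'_zero (Q : Type) [Preorder Q] :
    CFam' Q 0 = {L : QCclo Q | L.dom = ∅ ∨ ∃ x : ℝ, L.dom = {x}} :=
  Ordinal.limitRecOn_zero ..

theorem CFam'_add_one (Q : Type) [Preorder Q] (α : Ordinal) :
    CFam' Q (α + 1) = S'Sum (CFam' Q α) ∪ CFam' Q α :=
  Ordinal.limitRecOn_add_one ..

theorem CFam'_limit (Q : Type) [Preorder Q] {α : Ordinal} (hα : Order.IsSuccLimit α) :
    CFam' Q α = ⋃ (β : Ordinal) (_ : β < α), CFam' Q β := by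
  unfold CFam'
  exact Ordinal.limitRecOn_limit _ _ _ _ hα

theorem CFam'_mono (Q : Type) [Preorder Q] : Monotone (CFam' Q) := by
  intro α β
  induction β using Ordinal.limitRecOn with
  | zero => intro h; rw [le_antisymm h bot_le]
  | add_one β ih =>
    intro h
    rcases h.lt_or_eq with h | rfl
    · rw [CFam'_add_one]
      exact (ih (Order.lt_add_one_iff.1 h)).trans subset_union_right
    · exact le_rfl
  | limit β hβ ih =>
    intro h
    rcases h.lt_or_eq with h | rfl
    · rw [CFam'_limit Q hβ]
      exact subset_iUnion₂_of_subset α h le_rfl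
    · exact le_rfl

theorem isSuccLimit_aleph_one_ord : Order.IsSuccLimit (Cardinal.aleph 1).ord :=
  Cardinal.isSuccLimit_ord (Cardinal.aleph0_le_aleph 1)

theorem mem_CFam'_aleph_one_iff {Q : Type} [Preorder Q] {L : QCclo Q} :
    L ∈ CFam'.{u} Q (Cardinal.aleph 1).ord ↔
      ∃ β < (Cardinal.aleph.{u} 1).ord, L ∈ CFam'.{u} Q β := by
  rw [CFam'_limit Q isSuccLimit_aleph_one_ord]
  simp only [mem_iUnion, exists_prop]

theorem exists_bound_of_forall_mem_CFam' {Q : Type} [Preorder Q] {Ls : ℕ → QCclo Q}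
    (h : ∀ n, Ls n ∈ CFam'.{u} Q (Cardinal.aleph 1).ord) :
    ∃ β < (Cardinal.aleph.{u} 1).ord, ∀ n, Ls n ∈ CFam'.{u} Q β := by
  choose β hβ hL using fun n => mem_CFam'_aleph_one_iff.1 (h n)
  refine ⟨⨆ n, β n, ?_, fun n => CFam'_mono Q (Ordinal.le_iSup β n) (hL n)⟩
  rw [Cardinal.ord_aleph] at hβ ⊢
  exact Ordinal.iSup_lt_omega_one hβ

theorem S'Sum_mono {Q : Type} [Preorder Q] {O O' : Set (QCclo Q)} (h : O ⊆ O') :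
    S'Sum O ⊆ S'Sum O' := by
  rintro L ⟨Ls, Rs, p, x, hs, hL, hR, hh⟩
  exact ⟨Ls, Rs, p, x, hs, fun n => h (hL n), fun n => h (hR n), hh⟩

theorem S'Sum_CFam'_aleph_one_subset (Q : Type) [Preorder Q] :
    S'Sum (CFam'.{u} Q (Cardinal.aleph 1).ord) ⊆ CFam'.{u} Q (Cardinal.aleph 1).ord := by
  rintro L ⟨Ls, Rs, p, x, hs, hL, hR, hh⟩
  obtain ⟨β, hβ, hLβ⟩ := exists_bound_of_forall_mem_CFam' hL
  obtain ⟨γ, hγ, hRγ⟩ := exists_bound_of_forall_mem_CFam' hR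
  refine mem_CFam'_aleph_one_iff.2
    ⟨max β γ + 1, isSuccLimit_aleph_one_ord.add_one_lt (max_lt hβ hγ), ?_⟩
  rw [CFam'_add_one]
  exact Or.inl ⟨Ls, Rs, p, x, hs, fun n => CFam'_mono Q (le_max_left _ _) (hLβ n),
    fun n => CFam'_mono Q (le_max_right _ _) (hRγ n), hh⟩

theorem mem_CFam'_aleph_one_of_dom {Q : Type} [Preorder Q] {L : QCclo Q}
    (h : L.dom = ∅ ∨ ∃ x : ℝ, L.dom = {x}) : L ∈ CFam' Q (Cardinal.aleph 1).ord := by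
  refine CFam'_mono Q (zero_le : (0 : Ordinal) ≤ _) ?_
  rw [CFam'_zero]
  exact h

end Hierarchy

section Barrier

theorem isBarrier_singletons : IsBarrier (Set.range fun n : ℕ => ({n} : Finset ℕ)) := by
  refine ⟨⟨Set.infinite_range_of_injective Finset.singleton_injective, ?_⟩, ?_⟩
  · intro X hX _
    refine ⟨{sInf X}, ⟨_, rfl⟩, ?_⟩
    ext i
    simp only [Finset.coe_singleton, mem_singleton_iff, Finset.mem_singleton, exists_eq_left,
      mem_ofPred_eq]
    constructor
    · rintro rfl
      exact ⟨Nat.sInf_mem hX.nonempty, le_rfl⟩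
    · rintro ⟨hi, hle⟩
      exact le_antisymm hle (Nat.sInf_le hi)
  · rintro _ ⟨a, rfl⟩ _ ⟨b, rfl⟩ hab h
    exact hab (by simpa using h)

theorem exists_lt_of_barrierPrec_singleton {a b : ℕ}
    (h : BarrierPrec ({a} : Finset ℕ) {b}) : a < b := by
  obtain ⟨m, k, i, hk, hkm, hi, ha, hb⟩ := h
  have h1 : i 1 = a := by
    rw [← Finset.mem_singleton, ha]
    exact Finset.mem_image_of_mem _ (by simp; omega)
  have h2 : i 2 = b := by
    rw [← Finset.mem_singleton, hb]
    exact Finset.mem_image_of_mem _ (by simp; omega)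
  rw [← h1, ← h2]
  exact hi (by simp; omega) (by simp; omega) (by norm_num)

theorem IsBqoOn.isWqoOn {P : Type*} {r : P → P → Prop} {S : Set P} (h : IsBqoOn r S) :
    IsWqoOn r S := by
  intro f hf
  by_contra! hbad
  refine h _ isBarrier_singletons (fun b => f (sInf (b : Set ℕ))) (fun b _ => hf _) ?_
  rintro _ ⟨a, rfl⟩ _ ⟨b, rfl⟩ hab
  simpa using hbad a b (exists_lt_of_barrierPrec_singleton hab)

theorem IsWqoOn.exists_forall_exists_gt {P : Type*} {r : P → P → Prop} {S : Set P}
    (h : IsWqoOn r S) {f : ℕ → P} (hf : ∀ n, f n ∈ S) :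
    ∃ N, ∀ n ≥ N, ∃ k > n, r (f n) (f k) := by
  by_contra! hbad
  choose g hg hgr using hbad
  let s : ℕ → ℕ := fun n => Nat.rec (g 0) (fun _ m => g (m + 1)) n
  have hs : StrictMono s := strictMono_nat_of_lt_succ fun n => hg (s n + 1)
  obtain ⟨n, k, hnk, hr⟩ := h (fun n => f (s n)) fun n => hf _
  cases n with
  | zero => exact hgr 0 (s k) (hs hnk) hr
  | succ n => exact hgr (s n + 1) (s k) (hs hnk) hr

end Barrier

section Embeddings

theorem QCclo.Emb.refl {Q : Type} [Preorder Q] (A : QCclo Q) : QCclo.Emb A A :=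
  ⟨id, ⟨fun _ hx => hx, fun _ _ _ _ h => h, continuousOn_id⟩, fun _ _ => le_rfl⟩

theorem QCclo.Emb.trans {Q : Type} [Preorder Q] {A B C : QCclo Q}
    (h₁ : QCclo.Emb A B) (h₂ : QCclo.Emb B C) : QCclo.Emb A C := by
  obtain ⟨f, ⟨fm, fs, fc⟩, fl⟩ := h₁
  obtain ⟨g, ⟨gm, gs, gc⟩, gl⟩ := h₂
  exact ⟨g ∘ f, ⟨fun x hx => gm _ (fm x hx),
    fun x hx y hy h => gs _ (fm x hx) _ (fm y hy) (fs x hx y hy h), gc.comp fc fm⟩,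
    fun a ha => (fl a ha).trans (gl _ (fm a ha))⟩

instance QCclo.isPreorder_emb {Q : Type} [Preorder Q] : IsPreorder (QCclo Q) QCclo.Emb where
  refl := QCclo.Emb.refl
  trans _ _ _ := QCclo.Emb.trans

/-- `A` lies to the left of `B`, with a point strictly between them. -/
def SepLt (A B : Set ℝ) : Prop := ∃ c : ℝ, (∀ a ∈ A, a < c) ∧ ∀ b ∈ B, c < b

theorem SepLt.lt {A B : Set ℝ} (h : SepLt A B) {a b : ℝ} (ha : a ∈ A) (hb : b ∈ B) : a < b := by
  obtain ⟨c, h₁, h₂⟩ := h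
  exact (h₁ a ha).trans (h₂ b hb)

theorem isClosed_biUnion_dom {Q : Type} (l : List (QCclo Q)) : IsClosed (⋃ M ∈ l, M.dom) :=
  (l.finite_toSet).isClosed_biUnion fun M _ => M.dom_closed

/-- Label-increasing smc-embeddings between the domains of finite sums, obtained from
embeddings of the summands. -/
theorem exists_smcEmbedding_of_sublistForall₂ {Q : Type} [Preorder Q] {l l' : List (QCclo Q)}
    (h : List.SublistForall₂ QCclo.Emb l l')
    (hl : l.Pairwise fun A B => SepLt A.dom B.dom) (hl' : l'.Pairwise fun A B => SepLt A.dom B.dom)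
    {v v' : ℝ → Q} (hv : ∀ M ∈ l, ∀ y ∈ M.dom, v y = M.val y)
    (hv' : ∀ M ∈ l', ∀ y ∈ M.dom, v' y = M.val y) :
    ∃ f : ℝ → ℝ, IsSmcEmbedding (⋃ M ∈ l, M.dom) (⋃ M ∈ l', M.dom) f ∧
      ∀ a ∈ ⋃ M ∈ l, M.dom, v a ≤ v' (f a) := by
  induction h with
  | nil => exact ⟨id, ⟨by simp, by simp, by simp⟩, by simp⟩
  | cons_right h ih =>
    rw [List.pairwise_cons] at hl'
    obtain ⟨f, ⟨fm, fs, fc⟩, fl⟩ := ih hl hl'.2 hv fun M hM => hv' M (List.mem_cons_of_mem _ hM)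
    refine ⟨f, ⟨fun x hx => ?_, fs, fc⟩, fl⟩
    obtain ⟨M, hM, hx⟩ := mem_iUnion₂.1 (fm x hx)
    exact mem_iUnion₂.2 ⟨M, List.mem_cons_of_mem _ hM, hx⟩
  | @cons A B l l' hAB h ih =>
    rw [List.pairwise_cons] at hl hl'
    obtain ⟨g, ⟨gm, gs, gc⟩, gl⟩ := ih hl.2 hl'.2
      (fun M hM => hv M (List.mem_cons_of_mem _ hM)) fun M hM => hv' M (List.mem_cons_of_mem _ hM)
    obtain ⟨f, ⟨fm, fs, fc⟩, fl⟩ := hAB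
    have hlt : ∀ a ∈ A.dom, ∀ b ∈ ⋃ M ∈ l, M.dom, a < b := by
      intro a ha b hb
      obtain ⟨M, hM, hb⟩ := mem_iUnion₂.1 hb
      exact (hl.1 M hM).lt ha hb
    have hlt' : ∀ a ∈ B.dom, ∀ b ∈ ⋃ M ∈ l', M.dom, a < b := by
      intro a ha b hb
      obtain ⟨M, hM, hb⟩ := mem_iUnion₂.1 hb
      exact (hl'.1 M hM).lt ha hb
    classical
    have hU : ∀ (A : QCclo Q) (l : List (QCclo Q)),
        ⋃ M ∈ A :: l, M.dom = A.dom ∪ ⋃ M ∈ l, M.dom := by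
      intro A l
      ext x
      simp
    have hf : ∀ x ∈ A.dom, (A.dom.piecewise f g) x = f x := fun x hx => piecewise_eq_of_mem _ _ _ hx
    have hg : ∀ x ∈ ⋃ M ∈ l, M.dom, (A.dom.piecewise f g) x = g x := fun x hx =>
      piecewise_eq_of_notMem _ _ _ fun hA => lt_irrefl _ (hlt x hA x hx)
    rw [hU, hU]
    refine ⟨A.dom.piecewise f g, ⟨?_, ?_, ?_⟩, ?_⟩
    · rintro x (hx | hx)
      · rw [hf x hx]
        exact Or.inl (fm x hx)
      · rw [hg x hx]
        exact Or.inr (gm x hx)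
    · rintro x (hx | hx) y (hy | hy) hxy
      · rw [hf x hx, hf y hy]
        exact fs x hx y hy hxy
      · rw [hf x hx, hg y hy]
        exact hlt' _ (fm x hx) _ (gm y hy)
      · exact absurd hxy (hlt y hy x hx).not_gt
      · rw [hg x hx, hg y hy]
        exact gs x hx y hy hxy
    · exact (fc.congr hf).union_of_isClosed (gc.congr hg) A.dom_closed (isClosed_biUnion_dom l)
    · rintro x (hx | hx)
      · rw [hf x hx, hv A List.mem_cons_self x hx, hv' B List.mem_cons_self _ (fm x hx)]
        exact fl x hx
      · rw [hg x hx]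
        exact gl x hx

end Embeddings

section Compactification

open Real

/-- The two-point compactification of a `Q`-cclo, placed inside `[-π/2, π/2]`. -/
noncomputable def QCclo.compactify {Q : Type} (L : QCclo Q) : QCclo Q where
  dom := arctan '' L.dom ∪ {-(π / 2), π / 2}
  dom_countable := (L.dom_countable.image _).union (Set.toFinite _).countable
  dom_closed := by
    have h : (arctan '' L.dom ∪ {-(π / 2), π / 2})ᶜ =
        (Ioo (-(π / 2)) (π / 2) ∩ tan ⁻¹' L.domᶜ) ∪ Iio (-(π / 2)) ∪ Ioi (π / 2) := by
      ext t
      simp only [mem_compl_iff, mem_union, mem_image, mem_insert_iff, mem_singleton_iff, not_or,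
        not_exists, not_and, mem_inter_iff, mem_Ioo, mem_preimage, mem_Iio, mem_Ioi]
      constructor
      · rintro ⟨h₁, h₂, h₃⟩
        rcases lt_or_gt_of_ne h₂ with h₂ | h₂
        · exact Or.inl (Or.inr h₂)
        rcases lt_or_gt_of_ne h₃ with h₃ | h₃
        · exact Or.inl (Or.inl ⟨⟨h₂, h₃⟩, fun ht => h₁ _ ht (arctan_tan h₂ h₃)⟩)
        · exact Or.inr h₃
      · rintro ((⟨⟨h₂, h₃⟩, ht⟩ | h) | h)
        · refine ⟨?_, h₂.ne', h₃.ne⟩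
          rintro x hx rfl
          exact ht (by rwa [tan_arctan])
        · refine ⟨?_, h.ne, by linarith [pi_pos]⟩
          rintro x - rfl
          exact (neg_pi_div_two_lt_arctan x).not_gt h
        · refine ⟨?_, by linarith [pi_pos], h.ne'⟩
          rintro x - rfl
          exact (arctan_lt_pi_div_two x).not_gt h
    rw [← isOpen_compl_iff, h]
    exact ((continuousOn_tan_Ioo.isOpen_inter_preimage isOpen_Ioo
      L.dom_closed.isOpen_compl).union isOpen_Iio).union isOpen_Ioi
  val t := L.val (tan t)

theorem QCclo.isCompact_compactify {Q : Type} (L : QCclo Q) : IsCompact L.compactify.dom := by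
  refine (isCompact_Icc (a := -(π / 2)) (b := π / 2)).of_isClosed_subset
    L.compactify.dom_closed ?_
  have hπ := pi_pos
  rintro _ (⟨x, -, rfl⟩ | rfl | rfl)
  · exact ⟨(neg_pi_div_two_lt_arctan x).le, (arctan_lt_pi_div_two x).le⟩
  · exact ⟨le_rfl, by linarith⟩
  · exact ⟨by linarith, le_rfl⟩

theorem QCclo.Emb.of_compactify {Q : Type} [Preorder Q] {A B : QCclo Q}
    (h : QCclo.Emb A.compactify B.compactify) : QCclo.Emb A B := by
  obtain ⟨h, ⟨hm, hs, hc⟩, hl⟩ := h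
  have hA : ∀ x ∈ A.dom, arctan x ∈ A.compactify.dom := fun x hx => Or.inl ⟨x, hx, rfl⟩
  have hleft : -(π / 2) ∈ A.compactify.dom := Or.inr (Or.inl rfl)
  have hright : π / 2 ∈ A.compactify.dom := Or.inr (Or.inr rfl)
  have hπ := pi_pos
  have hB : B.compactify.dom ⊆ Icc (-(π / 2)) (π / 2) := by
    rintro _ (⟨x, -, rfl⟩ | rfl | rfl)
    · exact ⟨(neg_pi_div_two_lt_arctan x).le, (arctan_lt_pi_div_two x).le⟩
    · exact ⟨le_rfl, by linarith⟩
    · exact ⟨by linarith, le_rfl⟩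
  have hIoo : ∀ x ∈ A.dom, h (arctan x) ∈ Ioo (-(π / 2)) (π / 2) := fun x hx =>
    ⟨(hB (hm _ hleft)).1.trans_lt (hs _ hleft _ (hA x hx) (neg_pi_div_two_lt_arctan x)),
      (hs _ (hA x hx) _ hright (arctan_lt_pi_div_two x)).trans_le (hB (hm _ hright)).2⟩
  refine ⟨fun x => tan (h (arctan x)), ⟨fun x hx => ?_, fun x hx y hy hxy => ?_, ?_⟩,
    fun x hx => ?_⟩
  · have h₁ := hIoo x hx
    rcases hm _ (hA x hx) with ⟨y, hy, hxy⟩ | h₂ | h₂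
    · simpa only [← hxy, tan_arctan] using hy
    · exact absurd h₂ h₁.1.ne'
    · exact absurd h₂ h₁.2.ne
  · exact strictMonoOn_tan (hIoo x hx) (hIoo y hy)
      (hs _ (hA x hx) _ (hA y hy) (arctan_strictMono hxy))
  · exact continuousOn_tan_Ioo.comp (hc.comp continuous_arctan.continuousOn hA) hIoo
  · simpa only [QCclo.compactify, tan_arctan] using hl _ (hA x hx)

end Compactification

section Decomposition

/-- `D` is the union of a finite, left-to-right separated list of members of `𝓖`. -/
def IsFinUnion (𝓖 : Set (Set ℝ)) (D : Set ℝ) : Prop :=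
  ∃ l : List (Set ℝ), (∀ K ∈ l, K ∈ 𝓖) ∧ l.Pairwise SepLt ∧ D = ⋃ K ∈ l, K

theorem IsFinUnion.empty (𝓖 : Set (Set ℝ)) : IsFinUnion 𝓖 ∅ :=
  ⟨[], by simp, List.Pairwise.nil, by simp⟩

theorem IsFinUnion.of_mem {𝓖 : Set (Set ℝ)} {D : Set ℝ} (h : D ∈ 𝓖) : IsFinUnion 𝓖 D :=
  ⟨[D], by simpa, by simp, by simp⟩

theorem IsFinUnion.union {𝓖 : Set (Set ℝ)} {D E : Set ℝ} (hD : IsFinUnion 𝓖 D)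
    (hE : IsFinUnion 𝓖 E) (h : SepLt D E) : IsFinUnion 𝓖 (D ∪ E) := by
  obtain ⟨l, hl, hl', rfl⟩ := hD
  obtain ⟨m, hm, hm', rfl⟩ := hE
  obtain ⟨c, hc, hc'⟩ := h
  refine ⟨l ++ m, ?_, List.pairwise_append.2 ⟨hl', hm', fun A hA B hB => ⟨c, ?_, ?_⟩⟩, ?_⟩
  · intro K hK
    exact (List.mem_append.1 hK).elim (hl K) (hm K)
  · exact fun a ha => hc a (mem_iUnion₂.2 ⟨A, hA, ha⟩)
  · exact fun b hb => hc' b (mem_iUnion₂.2 ⟨B, hB, hb⟩)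
  · ext x
    simp [or_and_right, exists_or]

/-- Infinitely many nonempty lists can be concatenated into one sequence. -/
theorem exists_flatten_seq {α : Type*} {r : α → α → Prop} (l : ℕ → List α)
    (hne : ∀ n, l n ≠ []) (hr : ∀ n, (l n).Pairwise r)
    (hr' : ∀ i j, i < j → ∀ a ∈ l i, ∀ b ∈ l j, r a b) :
    ∃ m : ℕ → α, (∀ i j, i < j → r (m i) (m j)) ∧ ∀ a, (∃ k, m k = a) ↔ ∃ n, a ∈ l n := by
  let t : ℕ → List α := fun n => Nat.rec (l 0) (fun n s => s ++ l (n + 1)) n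
  have ht : ∀ n, t (n + 1) = t n ++ l (n + 1) := fun n => rfl
  have hlen : ∀ n, n < (t n).length := by
    intro n
    induction n with
    | zero => exact List.length_pos_iff.2 (hne 0)
    | succ n ih =>
      rw [ht, List.length_append]
      have := List.length_pos_iff.2 (hne (n + 1))
      omega
  have hpre : ∀ i j, i ≤ j → t i <+: t j := by
    intro i j hij
    induction hij with
    | refl => exact List.prefix_rfl
    | step _ ih => exact ih.trans (List.prefix_append _ _)
  have hmem : ∀ n a, a ∈ t n ↔ ∃ i ≤ n, a ∈ l i := by
    intro n a
    induction n with
    | zero => simp [t]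
    | succ n ih =>
      rw [ht, List.mem_append, ih]
      constructor
      · rintro (⟨i, hi, h⟩ | h)
        · exact ⟨i, by omega, h⟩
        · exact ⟨n + 1, le_rfl, h⟩
      · rintro ⟨i, hi, h⟩
        rcases hi.lt_or_eq with hi | rfl
        · exact Or.inl ⟨i, by omega, h⟩
        · exact Or.inr h
  have hpair : ∀ n, (t n).Pairwise r := by
    intro n
    induction n with
    | zero => exact hr 0
    | succ n ih =>
      rw [ht]
      refine List.pairwise_append.2 ⟨ih, hr _, fun a ha b hb => ?_⟩
      obtain ⟨i, hi, ha⟩ := (hmem n a).1 ha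
      exact hr' i (n + 1) (by omega) a ha b hb
  have hget : ∀ n k (hk : k < (t n).length), (t k)[k]'(hlen k) = (t n)[k] := by
    intro n k hk
    rcases le_total k n with h | h
    · exact (hpre k n h).getElem (hlen k)
    · exact ((hpre n k h).getElem hk).symm
  refine ⟨fun k => (t k)[k]'(hlen k), fun i j hij => ?_, fun a => ⟨?_, ?_⟩⟩
  · simp only
    rw [hget j i (hij.trans (hlen j))]
    exact List.pairwise_iff_getElem.1 (hpair j) i j _ _ hij
  · rintro ⟨k, rfl⟩
    obtain ⟨i, -, h⟩ := (hmem k _).1 (List.getElem_mem (hlen k))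
    exact ⟨i, h⟩
  · rintro ⟨n, h⟩
    obtain ⟨k, hk, rfl⟩ := List.getElem_of_mem ((hmem n a).2 ⟨n, le_rfl, h⟩)
    exact ⟨k, hget n k hk⟩

/-- `D` decomposes into a finite union of members of `𝓖` lying to the left of some `y < x`, and a
sequence of sets to the right of `y` converging to `x` from the left. The sequence either consists
of empty sets, or of members of `𝓖` with `e`-successors arbitrarily far out. -/
def HasLeftDecomposition (𝓖 : Set (Set ℝ)) (e : Set ℝ → Set ℝ → Prop) (c x : ℝ) (D : Set ℝ) :
    Prop :=
  ∃ (H : Set ℝ) (S : ℕ → Set ℝ) (y : ℝ), c < y ∧ y < x ∧ IsFinUnion 𝓖 H ∧ (∀ a ∈ H, a < y) ∧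
    (∀ n, ∀ a ∈ S n, y < a) ∧ D = H ∪ ⋃ n, S n ∧
    ((∀ n, S n = ∅) ∨ ((∀ n, S n ∈ 𝓖) ∧ ∀ n, ∃ k > n, e (S n) (S k))) ∧
    (∀ n, SepLt (S n) (S (n + 1))) ∧
    ∀ a : ℕ → ℝ, (∀ n, a n ∈ S n) → Tendsto a atTop (𝓝 x)

/-- Points outside `D`, starting at `c` and increasing to `x`, between any two of which there is
a point of `D`. -/
theorem exists_cut_seq {D : Set ℝ} (hD : D.Countable) {c x : ℝ} (hc : c ∉ D) (hcx : c < x)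
    (hlim : ∀ y < x, (D ∩ Ioo y x).Nonempty) :
    ∃ s : ℕ → ℝ, StrictMono s ∧ s 0 = c ∧ (∀ n, s n ∉ D) ∧ (∀ n, s n < x) ∧
      Tendsto s atTop (𝓝 x) ∧ ∀ n, (D ∩ Ioo (s n) (s (n + 1))).Nonempty := by
  have hdense : Dense Dᶜ := hD.dense_compl ℝ
  have hstep : ∀ (n : ℕ) (t : {t : ℝ // t < x ∧ t ∉ D}), ∃ u : {t : ℝ // t < x ∧ t ∉ D},
      (t : ℝ) < u ∧ x - 1 / ((n : ℝ) + 1) < u ∧ (D ∩ Ioo (t : ℝ) u).Nonempty := by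
    rintro n ⟨t, ht, htD⟩
    obtain ⟨z, hzD, hz⟩ := hlim t ht
    have hpos : (0 : ℝ) < 1 / ((n : ℝ) + 1) := by positivity
    obtain ⟨u, huD, hu⟩ := hdense.exists_between
      (max_lt hz.2 (sub_lt_self x hpos))
    have := max_lt_iff.1 hu.1
    exact ⟨⟨u, hu.2, huD⟩, hz.1.trans this.1, this.2, z, hzD, hz.1, this.1⟩
  choose next h₁ h₂ h₃ using hstep
  let s : ℕ → {t : ℝ // t < x ∧ t ∉ D} := fun n => Nat.rec ⟨c, hcx, hc⟩ next n
  let t : ℕ → ℝ := fun n => (s n).1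
  refine ⟨t, strictMono_nat_of_lt_succ fun n => h₁ n (s n), rfl, fun n => (s n).2.2,
    fun n => (s n).2.1, ?_, fun n => h₃ n (s n)⟩
  rw [← tendsto_add_atTop_iff_nat 1]
  refine tendsto_of_tendsto_of_tendsto_of_le_of_le (g := fun n : ℕ => x - 1 / ((n : ℝ) + 1))
    (h := fun _ => x) ?_ tendsto_const_nhds (fun n => (h₂ n (s n)).le) fun n => (s (n + 1)).2.1.le
  simpa using tendsto_const_nhds.sub (tendsto_one_div_add_atTop_nhds_zero_nat (𝕜 := ℝ))

theorem hasLeftDecomposition {𝓖 : Set (Set ℝ)} {e : Set ℝ → Set ℝ → Prop}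
    (hne : ∀ K ∈ 𝓖, K.Nonempty) (he : IsWqoOn e 𝓖) {D : Set ℝ} (hD : D.Countable) {c x : ℝ}
    (hc : c ∉ D) (hcx : c < x)
    (h : ∀ c' d', c ≤ c' → c' < d' → d' < x → c' ∉ D → d' ∉ D → IsFinUnion 𝓖 (D ∩ Ioo c' d')) :
    HasLeftDecomposition 𝓖 e c x (D ∩ Ioo c x) := by
  have hdense : Dense Dᶜ := hD.dense_compl ℝ
  by_cases hlim : ∀ y < x, (D ∩ Ioo y x).Nonempty
  · obtain ⟨s, hs, hs0, hsD, hsx, hst, hsne⟩ := exists_cut_seq hD hc hcx hlim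
    have hcs : ∀ n, c ≤ s n := fun n => hs0 ▸ hs.monotone (Nat.zero_le n)
    choose l hl hlr hlU using fun n =>
      h (s n) (s (n + 1)) (hcs n) (hs (Nat.lt_succ_self n)) (hsx _) (hsD _) (hsD _)
    have hlsub : ∀ n, ∀ K ∈ l n, K ⊆ D ∩ Ioo (s n) (s (n + 1)) := by
      intro n K hK a ha
      rw [hlU]
      exact mem_iUnion₂.2 ⟨K, hK, ha⟩
    obtain ⟨m, hmr, hm⟩ := exists_flatten_seq (r := SepLt) l
      (by
        intro n h0
        have := hsne n
        rw [hlU n, h0] at this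
        simp at this)
      hlr
      (by
        intro i j hij a ha b hb
        have hij' : s (i + 1) ≤ s j := hs.monotone hij
        exact ⟨s j, fun p hp => (hlsub i a ha hp).2.2.trans_le hij',
          fun p hp => (hlsub j b hb hp).2.1⟩)
    have hm𝓖 : ∀ k, m k ∈ 𝓖 := by
      intro k
      obtain ⟨n, hn⟩ := (hm (m k)).1 ⟨k, rfl⟩
      exact hl n _ hn
    have hmsub : ∀ k, m k ⊆ D ∩ Ioo c x := by
      intro k a ha
      obtain ⟨n, hn⟩ := (hm (m k)).1 ⟨k, rfl⟩
      have := hlsub n _ hn ha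
      exact ⟨this.1, (hcs n).trans_lt this.2.1, this.2.2.trans (hsx _)⟩
    obtain ⟨N, hN⟩ := he.exists_forall_exists_gt hm𝓖
    obtain ⟨y, hy, hy'⟩ := hmr N (N + 1) (Nat.lt_succ_self N)
    obtain ⟨p, hp⟩ := hne _ (hm𝓖 N)
    obtain ⟨q, hq⟩ := hne _ (hm𝓖 (N + 1))
    have hySep : ∀ k, ∀ a ∈ m (N + 1 + k), y < a := by
      intro k a ha
      rcases Nat.eq_zero_or_pos k with rfl | hk
      · exact hy' a ha
      · exact (hy' q hq).trans ((hmr (N + 1) (N + 1 + k) (by omega)).lt hq ha)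
    refine ⟨⋃ K ∈ (List.range (N + 1)).map m, K, fun n => m (N + 1 + n), y,
      (hmsub N hp).2.1.trans (hy p hp), (hy' q hq).trans (hmsub _ hq).2.2,
      ⟨_, ?_, ?_, rfl⟩, ?_, hySep, ?_, Or.inr ⟨fun n => hm𝓖 _, ?_⟩,
      fun n => hmr _ _ (by omega), ?_⟩
    · intro K hK
      obtain ⟨k, -, rfl⟩ := List.mem_map.1 hK
      exact hm𝓖 k
    · rw [List.pairwise_map]
      exact List.pairwise_lt_range.imp fun h => hmr _ _ h
    · intro a ha
      obtain ⟨K, hK, ha⟩ := mem_iUnion₂.1 ha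
      obtain ⟨k, hk, rfl⟩ := List.mem_map.1 hK
      rw [List.mem_range, Nat.lt_succ_iff] at hk
      rcases hk.lt_or_eq with hk | hk
      · exact ((hmr k N hk).lt ha hp).trans (hy p hp)
      · exact hy a (hk ▸ ha)
    · ext a
      constructor
      · rintro ⟨haD, hca, hax⟩
        have hex : ∃ n, a < s n := (hst.eventually_const_lt hax).exists
        classical
        have hn0 : Nat.find hex ≠ 0 := by
          intro h0
          have := Nat.find_spec hex
          rw [h0, hs0] at this
          exact this.not_gt hca
        obtain ⟨j, hj⟩ := Nat.exists_eq_succ_of_ne_zero hn0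
        have h₁ : a < s (j + 1) := by
          have := Nat.find_spec hex
          rwa [hj] at this
        have h₂ : s j ≤ a := not_lt.1 (Nat.find_min hex (by omega))
        have h₃ : a ∈ D ∩ Ioo (s j) (s (j + 1)) :=
          ⟨haD, h₂.lt_of_ne fun h => hsD j (h ▸ haD), h₁⟩
        rw [hlU] at h₃
        obtain ⟨K, hK, ha⟩ := mem_iUnion₂.1 h₃
        obtain ⟨k, rfl⟩ := (hm K).2 ⟨j, hK⟩
        rcases lt_or_ge k (N + 1) with hk | hk
        · exact Or.inl (mem_iUnion₂.2 ⟨m k, List.mem_map.2 ⟨k, List.mem_range.2 hk, rfl⟩, ha⟩)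
        · refine Or.inr (mem_iUnion.2 ⟨k - (N + 1), ?_⟩)
          rwa [Nat.add_sub_cancel' hk]
      · rintro (ha | ha)
        · obtain ⟨K, hK, ha⟩ := mem_iUnion₂.1 ha
          obtain ⟨k, -, rfl⟩ := List.mem_map.1 hK
          exact hmsub k ha
        · obtain ⟨k, ha⟩ := mem_iUnion.1 ha
          exact hmsub _ ha
    · intro n
      obtain ⟨k, hk, hek⟩ := hN (N + 1 + n) (by omega)
      refine ⟨k - (N + 1), by omega, ?_⟩
      simp only
      rwa [show N + 1 + (k - (N + 1)) = k by omega]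
    · intro a ha
      rw [tendsto_order]
      refine ⟨fun b hb => ?_, fun b hb => Eventually.of_forall fun n =>
        (hmsub _ (ha n)).2.2.trans hb⟩
      obtain ⟨n, hn⟩ := (hst.eventually_const_lt hb).exists
      obtain ⟨z, hz⟩ := hsne n
      have hzb := hn.trans hz.2.1
      rw [hlU] at hz
      obtain ⟨K, hK, hzK⟩ := mem_iUnion₂.1 hz
      obtain ⟨k, rfl⟩ := (hm K).2 ⟨n, hK⟩
      filter_upwards [eventually_ge_atTop k] with i hi
      exact hzb.trans ((hmr k (N + 1 + i) (by omega)).lt hzK (ha i))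
  · push Not at hlim
    obtain ⟨y, hyx, hy⟩ := hlim
    obtain ⟨z, hzD, hz⟩ := hdense.exists_between (max_lt hcx hyx)
    have hcz := (max_lt_iff.1 hz.1).1
    refine ⟨D ∩ Ioo c z, fun _ => ∅, z, hcz, hz.2, h c z le_rfl hcz hz.2 hc hzD,
      fun a ha => ha.2.2, by simp, ?_, Or.inl fun _ => rfl, fun n => ⟨0, by simp⟩, by simp⟩
    ext a
    simp only [iUnion_empty, union_empty, mem_inter_iff, mem_Ioo]
    refine ⟨fun ⟨haD, hca, hax⟩ => ⟨haD, hca, ?_⟩, fun ⟨haD, hca, haz⟩ => ⟨haD, hca, haz.trans hz.2⟩⟩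
    by_contra! hza
    have : a ∈ D ∩ Ioo y x := ⟨haD, ((max_lt_iff.1 hz.1).2).trans_le hza, hax⟩
    rw [hy] at this
    exact this

end Decomposition

section Reflection

open scoped Pointwise

theorem SepLt.neg {A B : Set ℝ} (h : SepLt A B) : SepLt (-B) (-A) := by
  obtain ⟨c, hA, hB⟩ := h
  exact ⟨-c, fun b hb => lt_neg.1 (hB _ hb), fun a ha => neg_lt.1 (hA _ ha)⟩

theorem IsFinUnion.neg {𝓖 𝓖' : Set (Set ℝ)} (h𝓖 : ∀ K ∈ 𝓖, -K ∈ 𝓖') {D : Set ℝ}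
    (h : IsFinUnion 𝓖 D) : IsFinUnion 𝓖' (-D) := by
  obtain ⟨l, hl, hl', rfl⟩ := h
  refine ⟨(l.map fun K => -K).reverse, ?_, ?_, ?_⟩
  · intro K hK
    obtain ⟨K', hK', rfl⟩ := List.mem_map.1 (List.mem_reverse.1 hK)
    exact h𝓖 _ (hl _ hK')
  · rw [List.pairwise_reverse, List.pairwise_map]
    exact hl'.imp fun h => h.neg
  · ext x
    simp only [Set.mem_neg, mem_iUnion₂, List.mem_reverse, List.mem_map, exists_prop]
    constructor
    · rintro ⟨K, hK, hx⟩
      exact ⟨-K, ⟨K, hK, rfl⟩, hx⟩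
    · rintro ⟨_, ⟨K, hK, rfl⟩, hx⟩
      exact ⟨K, hK, hx⟩

/-- The mirror image of `HasLeftDecomposition`. -/
def HasRightDecomposition (𝓖 : Set (Set ℝ)) (e : Set ℝ → Set ℝ → Prop) (x d : ℝ) (D : Set ℝ) :
    Prop :=
  ∃ (H : Set ℝ) (S : ℕ → Set ℝ) (y : ℝ), y < d ∧ x < y ∧ IsFinUnion 𝓖 H ∧ (∀ a ∈ H, y < a) ∧
    (∀ n, ∀ a ∈ S n, a < y) ∧ D = H ∪ ⋃ n, S n ∧
    ((∀ n, S n = ∅) ∨ ((∀ n, S n ∈ 𝓖) ∧ ∀ n, ∃ k > n, e (S n) (S k))) ∧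
    (∀ n, SepLt (S (n + 1)) (S n)) ∧
    ∀ a : ℕ → ℝ, (∀ n, a n ∈ S n) → Tendsto a atTop (𝓝 x)

theorem HasLeftDecomposition.neg {𝓖 𝓖' : Set (Set ℝ)} {e e' : Set ℝ → Set ℝ → Prop}
    (h𝓖 : ∀ K ∈ 𝓖, -K ∈ 𝓖') (he : ∀ K K', e K K' → e' (-K) (-K')) {c x : ℝ} {D : Set ℝ}
    (h : HasLeftDecomposition 𝓖 e c x D) : HasRightDecomposition 𝓖' e' (-x) (-c) (-D) := by
  obtain ⟨H, S, y, hcy, hyx, hH, hHy, hSy, rfl, hS, hsep, hlim⟩ := h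
  refine ⟨-H, fun n => -S n, -y, neg_lt_neg hcy, neg_lt_neg hyx, hH.neg h𝓖,
    fun a ha => neg_lt.1 (hHy _ ha), fun n a ha => lt_neg.1 (hSy n _ ha), ?_, ?_,
    fun n => (hsep n).neg, fun a ha => ?_⟩
  · ext a
    simp
  · rcases hS with hS | ⟨hS, hSe⟩
    · exact Or.inl fun n => by simp [hS n]
    · refine Or.inr ⟨fun n => h𝓖 _ (hS n), fun n => ?_⟩
      obtain ⟨k, hk, hek⟩ := hSe n
      exact ⟨k, hk, he _ _ hek⟩
  · simpa using (hlim (fun n => -a n) ha).neg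

theorem hasRightDecomposition {𝓖 : Set (Set ℝ)} {e : Set ℝ → Set ℝ → Prop}
    (hne : ∀ K ∈ 𝓖, K.Nonempty) (he : IsWqoOn e 𝓖) {D : Set ℝ} (hD : D.Countable) {x d : ℝ}
    (hd : d ∉ D) (hxd : x < d)
    (h : ∀ c' d', x < c' → c' < d' → d' ≤ d → c' ∉ D → d' ∉ D → IsFinUnion 𝓖 (D ∩ Ioo c' d')) :
    HasRightDecomposition 𝓖 e x d (D ∩ Ioo x d) := by
  have hwqo : IsWqoOn (fun K K' => e (-K) (-K')) {K | -K ∈ 𝓖} := fun f hf =>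
    he (fun n => -f n) hf
  have key := hasLeftDecomposition (𝓖 := {K | -K ∈ 𝓖}) (e := fun K K' => e (-K) (-K'))
    (D := -D) (c := -d) (x := -x) (fun K hK => by simpa using hne _ hK) hwqo
    (by simpa using hD.image Neg.neg) (by simpa) (neg_lt_neg hxd) (by
      intro c' d' hc hcd hd' hcD hdD
      have := (h (-d') (-c') (lt_neg.1 hd') (neg_lt_neg hcd) (neg_le.1 hc) hdD hcD).neg
        (𝓖' := {K | -K ∈ 𝓖}) (by simp)
      simpa using this)
  have := key.neg (𝓖' := 𝓖) (e' := e) (fun _ hK => hK) (fun _ _ hK => hK)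
  simpa using this

end Reflection

section Summands

variable {Q : Type}

/-- The restriction of `L` to (the closure of) `K`. -/
def QCclo.restr (L : QCclo Q) (K : Set ℝ) : QCclo Q where
  dom := L.dom ∩ closure K
  dom_countable := L.dom_countable.mono inter_subset_left
  dom_closed := L.dom_closed.inter isClosed_closure
  val := L.val

theorem QCclo.restr_dom {L : QCclo Q} {K : Set ℝ} (hK : IsClosed K) (hKL : K ⊆ L.dom) :
    (L.restr K).dom = K :=
  (congrArg (L.dom ∩ ·) hK.closure_eq).trans (inter_eq_right.2 hKL)

/-- The nonempty closed pieces of `L` on which `L` belongs to `O`. -/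
def pieces (O : Set (QCclo Q)) (L : QCclo Q) : Set (Set ℝ) :=
  {K | IsClosed K ∧ K ⊆ L.dom ∧ K.Nonempty ∧ L.restr K ∈ O}

variable [Preorder Q] {O : Set (QCclo Q)} {L : QCclo Q}

theorem isWqoOn_pieces (hwqo : IsWqoOn QCclo.Emb O) :
    IsWqoOn (fun K K' => QCclo.Emb (L.restr K) (L.restr K')) (pieces O L) := fun f hf =>
  hwqo (fun n => L.restr (f n)) fun n => (hf n).2.2.2

theorem mem_pieces_of_sum (hO : ∀ M : QCclo Q, (M.dom = ∅ ∨ ∃ x : ℝ, M.dom = {x}) → M ∈ O)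
    (hS : S'Sum O ⊆ O) {x : ℝ} (hx : x ∈ L.dom) {Ls Rs : ℕ → Set ℝ}
    (hLs : (∀ n, Ls n = ∅) ∨ ((∀ n, Ls n ∈ pieces O L) ∧
      ∀ n, ∃ k > n, QCclo.Emb (L.restr (Ls n)) (L.restr (Ls k))))
    (hRs : (∀ n, Rs n = ∅) ∨ ((∀ n, Rs n ∈ pieces O L) ∧
      ∀ n, ∃ k > n, QCclo.Emb (L.restr (Rs n)) (L.restr (Rs k))))
    (hLsep : ∀ n, SepLt (Ls n) (Ls (n + 1))) (hRsep : ∀ n, SepLt (Rs (n + 1)) (Rs n))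
    (hLx : ∀ n, ∀ a ∈ Ls n, a < x) (hRx : ∀ n, ∀ a ∈ Rs n, x < a)
    (hLlim : ∀ a : ℕ → ℝ, (∀ n, a n ∈ Ls n) → Tendsto a atTop (𝓝 x))
    (hRlim : ∀ a : ℕ → ℝ, (∀ n, a n ∈ Rs n) → Tendsto a atTop (𝓝 x))
    (hcl : IsClosed ((⋃ n, Ls n) ∪ {x} ∪ ⋃ n, Rs n)) :
    ((⋃ n, Ls n) ∪ {x} ∪ ⋃ n, Rs n) ∈ pieces O L := by
  have aux : ∀ S : ℕ → Set ℝ, ((∀ n, S n = ∅) ∨ ((∀ n, S n ∈ pieces O L) ∧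
      ∀ n, ∃ k > n, QCclo.Emb (L.restr (S n)) (L.restr (S k)))) →
      (∀ n, (L.restr (S n)).dom = S n) ∧ (∀ n, L.restr (S n) ∈ O) ∧ (∀ n, S n ⊆ L.dom) ∧
      (∀ n, ∃ k > n, QCclo.Emb (L.restr (S n)) (L.restr (S k))) ∧
      ((∀ n, S n = ∅) ∨ ∀ n, (S n).Nonempty) := by
    rintro S (hS | ⟨hS, hSe⟩)
    · have h0 : ∀ n, (L.restr (S n)).dom = S n := fun n => by simp [QCclo.restr, hS n]
      exact ⟨h0, fun n => hO _ (Or.inl ((h0 n).trans (hS n))), fun n => by simp [hS n],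
        fun n => ⟨n + 1, Nat.lt_succ_self n, by rw [hS n, hS (n + 1)]; exact QCclo.Emb.refl _⟩,
        Or.inl hS⟩
    · exact ⟨fun n => QCclo.restr_dom (hS n).1 (hS n).2.1, fun n => (hS n).2.2.2,
        fun n => (hS n).2.1, hSe, Or.inr fun n => (hS n).2.2.1⟩
  obtain ⟨hL1, hL2, hL3, hL4, hL5⟩ := aux Ls hLs
  obtain ⟨hR1, hR2, hR3, hR4, hR5⟩ := aux Rs hRs
  have hsub : ((⋃ n, Ls n) ∪ {x} ∪ ⋃ n, Rs n) ⊆ L.dom :=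
    union_subset (union_subset (iUnion_subset hL3) (singleton_subset_iff.2 hx))
      (iUnion_subset hR3)
  have hdom := QCclo.restr_dom hcl hsub
  refine ⟨hcl, hsub, ⟨x, Or.inl (Or.inr rfl)⟩, ?_⟩
  by_cases h0 : (∀ n, Ls n = ∅) ∧ ∀ n, Rs n = ∅
  · refine hO _ (Or.inr ⟨x, ?_⟩)
    rw [hdom]
    simp [h0.1, h0.2]
  · refine hS ⟨fun n => L.restr (Ls n), fun n => L.restr (Rs n), L.val x, x, ?_, hL2, hR2, hL4, hR4⟩
    simp only [IsOmegaSum, hL1, hR1, hdom]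
    exact ⟨hL5, hR5, h0, fun n => Or.inr (Or.inr (hLsep n)),
      fun n => Or.inr (Or.inr ⟨x, hLx _, hRx _⟩), fun n => Or.inr (Or.inr (hRsep n)),
      hLlim, hRlim, trivial, fun _ _ _ => rfl, fun _ _ _ => rfl, rfl⟩

theorem isFinUnion_of_hasDecompositions
    (hO : ∀ M : QCclo Q, (M.dom = ∅ ∨ ∃ x : ℝ, M.dom = {x}) → M ∈ O) (hS : S'Sum O ⊆ O)
    {c x d : ℝ} (hx : x ∈ L.dom)
    (hl : HasLeftDecomposition (pieces O L)
      (fun K K' => QCclo.Emb (L.restr K) (L.restr K')) c x (L.dom ∩ Ioo c x))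
    (hr : HasRightDecomposition (pieces O L)
      (fun K K' => QCclo.Emb (L.restr K) (L.restr K')) x d (L.dom ∩ Ioo x d)) :
    IsFinUnion (pieces O L) (L.dom ∩ Ioo c d) := by
  obtain ⟨H, S, y, hcy, hyx, hH, hHy, hSy, hU, hSS, hsep, hlim⟩ := hl
  obtain ⟨H', S', y', hyd', hxy', hH', hHy', hSy', hU', hSS', hsep', hlim'⟩ := hr
  have hSsub : ∀ n, ∀ a ∈ S n, a ∈ L.dom ∩ Ioo c x := fun n a ha =>
    hU ▸ Or.inr (mem_iUnion.2 ⟨n, ha⟩)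
  have hSsub' : ∀ n, ∀ a ∈ S' n, a ∈ L.dom ∩ Ioo x d := fun n a ha =>
    hU' ▸ Or.inr (mem_iUnion.2 ⟨n, ha⟩)
  have hHsub : ∀ a ∈ H, a ∈ L.dom ∩ Ioo c x := fun a ha => hU ▸ Or.inl ha
  have hHsub' : ∀ a ∈ H', a ∈ L.dom ∩ Ioo x d := fun a ha => hU' ▸ Or.inl ha
  have hK : (⋃ n, S n) ∪ {x} ∪ ⋃ n, S' n = L.dom ∩ Icc y y' := by
    ext a
    constructor
    · rintro ((ha | rfl) | ha)
      · obtain ⟨n, ha⟩ := mem_iUnion.1 ha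
        exact ⟨(hSsub n a ha).1, (hSy n a ha).le, ((hSsub n a ha).2.2.trans hxy').le⟩
      · exact ⟨hx, hyx.le, hxy'.le⟩
      · obtain ⟨n, ha⟩ := mem_iUnion.1 ha
        exact ⟨(hSsub' n a ha).1, (hyx.trans (hSsub' n a ha).2.1).le, (hSy' n a ha).le⟩
    · rintro ⟨haL, hay, hay'⟩
      rcases lt_trichotomy a x with hax | rfl | hax
      · have : a ∈ L.dom ∩ Ioo c x := ⟨haL, hcy.trans_le hay, hax⟩
        rw [hU] at this
        rcases this with ha | ha
        · exact absurd (hHy a ha) hay.not_gt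
        · exact Or.inl (Or.inl ha)
      · exact Or.inl (Or.inr rfl)
      · have : a ∈ L.dom ∩ Ioo x d := ⟨haL, hax, hay'.trans_lt hyd'⟩
        rw [hU'] at this
        rcases this with ha | ha
        · exact absurd (hHy' a ha) hay'.not_gt
        · exact Or.inr ha
  have hmem := mem_pieces_of_sum hO hS hx hSS hSS' hsep hsep'
    (fun n a ha => (hSsub n a ha).2.2) (fun n a ha => (hSsub' n a ha).2.1) hlim hlim'
    (hK ▸ L.dom_closed.inter isClosed_Icc)
  have hKIoo : ∀ a ∈ (⋃ n, S n) ∪ {x} ∪ ⋃ n, S' n, y < a ∧ a < y' := by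
    rintro a ((ha | rfl) | ha)
    · obtain ⟨n, ha⟩ := mem_iUnion.1 ha
      exact ⟨hSy n a ha, (hSsub n a ha).2.2.trans hxy'⟩
    · exact ⟨hyx, hxy'⟩
    · obtain ⟨n, ha⟩ := mem_iUnion.1 ha
      exact ⟨hyx.trans (hSsub' n a ha).2.1, hSy' n a ha⟩
  have hunion : L.dom ∩ Ioo c d = (H ∪ ((⋃ n, S n) ∪ {x} ∪ ⋃ n, S' n)) ∪ H' := by
    ext a
    constructor
    · rintro ⟨haL, hca, had⟩
      rcases lt_trichotomy a x with hax | rfl | hax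
      · have : a ∈ L.dom ∩ Ioo c x := ⟨haL, hca, hax⟩
        rw [hU] at this
        exact this.elim (fun h => Or.inl (Or.inl h)) fun h => Or.inl (Or.inr (Or.inl (Or.inl h)))
      · exact Or.inl (Or.inr (Or.inl (Or.inr rfl)))
      · have : a ∈ L.dom ∩ Ioo x d := ⟨haL, hax, had⟩
        rw [hU'] at this
        exact this.elim Or.inr fun h => Or.inl (Or.inr (Or.inr h))
    · rintro ((ha | ha) | ha)
      · have := hHsub a ha
        exact ⟨this.1, this.2.1, this.2.2.trans (hxy'.trans hyd')⟩
      · have := hKIoo a ha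
        exact ⟨hmem.2.1 ha, hcy.trans this.1, this.2.trans hyd'⟩
      · have := hHsub' a ha
        exact ⟨this.1, hcy.trans (hyx.trans this.2.1), this.2.2⟩
  rw [hunion]
  refine (hH.union (.of_mem hmem) ⟨y, hHy, fun a ha => (hKIoo a ha).1⟩).union hH'
    ⟨y', ?_, hHy'⟩
  rintro a (ha | ha)
  · exact (hHy a ha).trans (hyx.trans hxy')
  · exact (hKIoo a ha).2

/-- Every part of `D` cut out by two points of `[c, d]` off `D` is a finite union of members
of `𝓖`. -/
def IsGoodInterval (𝓖 : Set (Set ℝ)) (D : Set ℝ) (c d : ℝ) : Prop :=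
  ∀ c' d', c ≤ c' → c' < d' → d' ≤ d → c' ∉ D → d' ∉ D → IsFinUnion 𝓖 (D ∩ Ioo c' d')

theorem IsGoodInterval.mono {𝓖 : Set (Set ℝ)} {D : Set ℝ} {c d c₁ d₁ : ℝ}
    (h : IsGoodInterval 𝓖 D c d) (hc : c ≤ c₁) (hd : d₁ ≤ d) : IsGoodInterval 𝓖 D c₁ d₁ :=
  fun c' d' h₁ h₂ h₃ => h c' d' (hc.trans h₁) h₂ (h₃.trans hd)

theorem IsGoodInterval.trans {𝓖 : Set (Set ℝ)} {D : Set ℝ} {c u d : ℝ} (hu : u ∉ D)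
    (h₁ : IsGoodInterval 𝓖 D c u) (h₂ : IsGoodInterval 𝓖 D u d) : IsGoodInterval 𝓖 D c d := by
  intro c' d' hc hcd hd hcD hdD
  rcases le_or_gt d' u with hdu | hud
  · exact h₁ c' d' hc hcd hdu hcD hdD
  rcases le_or_gt u c' with huc | hcu
  · exact h₂ c' d' huc hcd hd hcD hdD
  have : D ∩ Ioo c' d' = (D ∩ Ioo c' u) ∪ (D ∩ Ioo u d') := by
    ext a
    constructor
    · rintro ⟨haD, hca, had⟩
      rcases lt_trichotomy a u with h | rfl | h
      · exact Or.inl ⟨haD, hca, h⟩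
      · exact absurd haD hu
      · exact Or.inr ⟨haD, h, had⟩
    · rintro (⟨haD, h⟩ | ⟨haD, h⟩)
      · exact ⟨haD, h.1, h.2.trans hud⟩
      · exact ⟨haD, hcu.trans h.1, h.2⟩
  rw [this]
  exact (h₁ c' u hc hcu le_rfl hcD hu).union (h₂ u d' le_rfl hud hd hu hdD)
    ⟨u, fun a ha => ha.2.2, fun a ha => ha.2.1⟩

/-- The points without a neighbourhood that is a good interval with end points off `D`. -/
def badPoints (𝓖 : Set (Set ℝ)) (D : Set ℝ) : Set ℝ :=
  {x | ∀ u w, u < x → x < w → u ∉ D → w ∉ D → ¬ IsGoodInterval 𝓖 D u w}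

theorem isClosed_badPoints (𝓖 : Set (Set ℝ)) (D : Set ℝ) : IsClosed (badPoints 𝓖 D) := by
  rw [← isOpen_compl_iff, isOpen_iff_mem_nhds]
  intro x hx
  simp only [badPoints, mem_compl_iff, mem_ofPred_eq, not_forall, not_not] at hx
  obtain ⟨u, w, hu, hw, huD, hwD, hg⟩ := hx
  filter_upwards [Ioo_mem_nhds hu hw] with z hz hbad
  exact hbad u w hz.1 hz.2 huD hwD hg

theorem badPoints_subset (𝓖 : Set (Set ℝ)) {D : Set ℝ} (hD : D.Countable) (hDc : IsClosed D) :
    badPoints 𝓖 D ⊆ D := by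
  have hdense : Dense Dᶜ := hD.dense_compl ℝ
  intro x hx
  by_contra hxD
  obtain ⟨a, b, ⟨hax, hxb⟩, hab⟩ :=
    mem_nhds_iff_exists_Ioo_subset.1 (hDc.isOpen_compl.mem_nhds hxD)
  obtain ⟨u, huD, hu⟩ := hdense.exists_between hax
  obtain ⟨w, hwD, hw⟩ := hdense.exists_between hxb
  refine hx u w hu.2 hw.1 huD hwD fun c' d' hc hcd hd _ _ => ?_
  have : D ∩ Ioo c' d' = ∅ := by
    ext z
    simp only [mem_inter_iff, mem_empty_iff_false, iff_false, not_and]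
    exact fun hz hz' => hab ⟨hu.1.trans_le (hc.trans hz'.1.le), (hz'.2.le.trans hd).trans_lt hw.2⟩ hz
  rw [this]
  exact .empty 𝓖

theorem isGoodInterval_of_disjoint_badPoints {𝓖 : Set (Set ℝ)} {D : Set ℝ} {c d : ℝ}
    (hcd : c ≤ d) (h : ∀ z ∈ Icc c d, z ∉ badPoints 𝓖 D) : IsGoodInterval 𝓖 D c d := by
  let T := {t ∈ Icc c d | IsGoodInterval 𝓖 D c t}
  have hcT : c ∈ T := ⟨⟨le_rfl, hcd⟩, fun c' d' h₁ h₂ h₃ =>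
    absurd (h₁.trans_lt (h₂.trans_le h₃)) (lt_irrefl c)⟩
  have hT : BddAbove T := ⟨d, fun t ht => ht.1.2⟩
  have hcs : c ≤ sSup T := le_csSup hT hcT
  have hsd : sSup T ≤ d := csSup_le ⟨c, hcT⟩ fun t ht => ht.1.2
  have hs := h _ ⟨hcs, hsd⟩
  simp only [badPoints, mem_ofPred_eq, not_forall, not_not] at hs
  obtain ⟨u, w, hu, hw, huD, hwD, hg⟩ := hs
  obtain ⟨t, ht, hut⟩ := exists_lt_of_lt_csSup ⟨c, hcT⟩ hu
  have hcw : IsGoodInterval 𝓖 D c w := by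
    rcases le_total c u with hcu | huc
    · exact (ht.2.mono le_rfl hut.le).trans huD hg
    · exact hg.mono huc le_rfl
  rcases le_or_gt d w with hdw | hwd
  · exact hcw.mono le_rfl hdw
  · exact absurd (le_csSup hT (⟨⟨hcs.trans hw.le, hwd.le⟩, hcw⟩ : w ∈ T)) hw.not_ge

theorem exists_isolated_of_countable {P : Set ℝ} (hP : P.Countable) (hPc : IsClosed P)
    (hne : P.Nonempty) : ∃ x ∈ P, ∃ a b, a < x ∧ x < b ∧ ∀ z ∈ Ioo a b, z ∈ P → z = x := by
  by_contra! hcon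
  have hperf : Perfect P := by
    refine ⟨hPc, preperfect_iff_nhds.2 fun x hx U hU => ?_⟩
    obtain ⟨a, b, ⟨hax, hxb⟩, hab⟩ := mem_nhds_iff_exists_Ioo_subset.1 hU
    obtain ⟨z, hz, hzP, hzx⟩ := hcon x hx a b hax hxb
    exact ⟨z, ⟨hab hz, hzP⟩, hzx⟩
  obtain ⟨f, hf, -, hinj⟩ := hperf.exists_nat_bool_injection hne
  have hcount : (univ : Set (ℕ → Bool)).Countable :=
    (mapsTo_univ_iff.2 fun x => hf ⟨x, rfl⟩).countable_of_injOn hinj.injOn hP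
  have := countable_univ_iff.1 hcount
  obtain ⟨g, hg⟩ := exists_injective_nat (ℕ → Bool)
  classical
  refine Function.cantor_injective (fun s : Set ℕ => g fun n => decide (n ∈ s)) fun s t hst => ?_
  ext n
  simpa using congrFun (hg hst) n

theorem badPoints_pieces_eq_empty
    (hO : ∀ M : QCclo Q, (M.dom = ∅ ∨ ∃ x : ℝ, M.dom = {x}) → M ∈ O) (hS : S'Sum O ⊆ O)
    (hwqo : IsWqoOn QCclo.Emb O) : badPoints (pieces O L) L.dom = ∅ := by
  have hdense : Dense L.domᶜ := L.dom_countable.dense_compl ℝ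
  have hsub := badPoints_subset (pieces O L) L.dom_countable L.dom_closed
  by_contra hne
  obtain ⟨x, hx, a, b, hax, hxb, hab⟩ := exists_isolated_of_countable
    (L.dom_countable.mono hsub) (isClosed_badPoints _ _) (nonempty_iff_ne_empty.2 hne)
  have hxL := hsub hx
  obtain ⟨u, huD, hu⟩ := hdense.exists_between hax
  obtain ⟨w, hwD, hw⟩ := hdense.exists_between hxb
  refine hx u w hu.2 hw.1 huD hwD fun c d hc hcd hd hcD hdD => ?_
  have hac := hu.1.trans_le hc
  have hdb := hd.trans_lt hw.2
  have hgood : ∀ c' d', c ≤ c' → c' < d' → d' ≤ d → (d' < x ∨ x < c') → c' ∉ L.dom →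
      d' ∉ L.dom → IsFinUnion (pieces O L) (L.dom ∩ Ioo c' d') := by
    intro c' d' h₁ h₂ h₃ h₄ h₅ h₆
    refine isGoodInterval_of_disjoint_badPoints h₂.le (fun z hz hzP => ?_) c' d' le_rfl h₂ le_rfl
      h₅ h₆
    have := hab z ⟨hac.trans_le (h₁.trans hz.1), (hz.2.trans h₃).trans_lt hdb⟩ hzP
    rcases h₄ with h₄ | h₄
    · exact (hz.2.trans_lt h₄).ne this
    · exact (h₄.trans_le hz.1).ne' this
  rcases lt_trichotomy x c with hxc | rfl | hcx
  · exact hgood c d le_rfl hcd le_rfl (Or.inr hxc) hcD hdD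
  · exact absurd hxL hcD
  rcases lt_trichotomy d x with hdx | rfl | hxd
  · exact hgood c d le_rfl hcd le_rfl (Or.inl hdx) hcD hdD
  · exact absurd hxL hdD
  have hne : ∀ K ∈ pieces O L, K.Nonempty := fun K hK => hK.2.2.1
  exact isFinUnion_of_hasDecompositions hO hS hxL
    (hasLeftDecomposition hne (isWqoOn_pieces hwqo) L.dom_countable hcD hcx
      fun c' d' h₁ h₂ h₃ => hgood c' d' h₁ h₂ (h₃.le.trans hxd.le) (Or.inl h₃))
    (hasRightDecomposition hne (isWqoOn_pieces hwqo) L.dom_countable hdD hxd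
      fun c' d' h₁ h₂ h₃ => hgood c' d' (hcx.le.trans h₁.le) h₂ h₃ (Or.inr h₁))

/-- A compact `Q`-cclo is a finite sum of members of `O`. -/
theorem isFinUnion_dom_of_isCompact
    (hO : ∀ M : QCclo Q, (M.dom = ∅ ∨ ∃ x : ℝ, M.dom = {x}) → M ∈ O) (hS : S'Sum O ⊆ O)
    (hwqo : IsWqoOn QCclo.Emb O) (hL : IsCompact L.dom) : IsFinUnion (pieces O L) L.dom := by
  obtain ⟨a, ha⟩ := hL.bddBelow
  obtain ⟨b, hb⟩ := hL.bddAbove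
  have hsub : L.dom ⊆ Ioo (min a b - 1) (max a b + 1) := fun z hz =>
    ⟨by linarith [ha hz, min_le_left a b], by linarith [hb hz, le_max_right a b]⟩
  have hlt : min a b - 1 < max a b + 1 := by linarith [min_le_max (a := a) (b := b)]
  have := isGoodInterval_of_disjoint_badPoints (𝓖 := pieces O L) (D := L.dom) hlt.le
    (by simp [badPoints_pieces_eq_empty hO hS hwqo]) _ _ le_rfl hlt le_rfl
    (fun h => lt_irrefl _ (hsub h).1) fun h => lt_irrefl _ (hsub h).2
  rwa [inter_eq_left.2 hsub] at this

theorem isWqoOn_isCompact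
    (hO : ∀ M : QCclo Q, (M.dom = ∅ ∨ ∃ x : ℝ, M.dom = {x}) → M ∈ O) (hS : S'Sum O ⊆ O)
    (hwqo : IsWqoOn QCclo.Emb O) : IsWqoOn QCclo.Emb {L : QCclo Q | IsCompact L.dom} := by
  intro f hf
  choose l hl hlr hlU using fun n => isFinUnion_dom_of_isCompact hO hS hwqo (hf n)
  have hdom : ∀ n, ∀ K ∈ l n, ((f n).restr K).dom = K := fun n K hK =>
    QCclo.restr_dom (hl n K hK).1 (hl n K hK).2.1
  have hpwo : O.PartiallyWellOrderedOn QCclo.Emb :=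
    partiallyWellOrderedOn_iff_exists_lt.2 fun g hg => hwqo g hg
  obtain ⟨i, j, hij, h⟩ := (hpwo.partiallyWellOrderedOn_sublistForall₂ _).exists_lt
    (f := fun n => (l n).map (f n).restr) (fun n M hM => by
      obtain ⟨K, hK, rfl⟩ := List.mem_map.1 hM
      exact (hl n K hK).2.2.2)
  have hpair : ∀ n, ((l n).map (f n).restr).Pairwise fun A B => SepLt A.dom B.dom := by
    intro n
    rw [List.pairwise_map]
    refine (hlr n).imp_of_mem fun hA hB hAB => ?_
    rwa [hdom n _ hA, hdom n _ hB]
  have hU : ∀ n, ⋃ M ∈ (l n).map (f n).restr, M.dom = (f n).dom := by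
    intro n
    rw [hlU n]
    ext x
    simp only [List.mem_map, mem_iUnion, exists_prop]
    constructor
    · rintro ⟨_, ⟨K, hK, rfl⟩, hx⟩
      exact ⟨K, hK, hdom n K hK ▸ hx⟩
    · rintro ⟨K, hK, hx⟩
      exact ⟨_, ⟨K, hK, rfl⟩, (hdom n K hK).symm ▸ hx⟩
  have hval : ∀ n, ∀ M ∈ (l n).map (f n).restr, ∀ y ∈ M.dom, (f n).val y = M.val y := by
    intro n M hM y _
    obtain ⟨K, -, rfl⟩ := List.mem_map.1 hM
    rfl
  obtain ⟨g, hg, hgl⟩ := exists_smcEmbedding_of_sublistForall₂ h (hpair i) (hpair j)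
    (hval i) (hval j)
  rw [hU, hU] at hg
  rw [hU] at hgl
  exact ⟨i, j, hij, g, hg, hgl⟩

end Summands

/-- If `(C'_{ω₁}, ⪯)` is a bqo, then the class `C` of all `Q`-cclos is a wqo
under smc-embeddability `⪯`. -/
theorem stmt2 (Q : Type) [Preorder Q]
    (h : IsBqoOn (QCclo.Emb (Q := Q)) (CFam' Q ((Cardinal.aleph 1).ord))) :
    IsWqoOn (QCclo.Emb (Q := Q)) Set.univ := by
  intro f _
  obtain ⟨i, j, hij, hemb⟩ := isWqoOn_isCompact (fun _ => mem_CFam'_aleph_one_of_dom)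
    (S'Sum_CFam'_aleph_one_subset Q) h.isWqoOn (fun n => (f n).compactify)
    fun n => (f n).isCompact_compactify
  exact ⟨i, j, hij, hemb.of_compactify⟩
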